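/- arXiv:1902.07457 — 2 statements merged into one kernel-verified Lean document; each statement's English description precedes it below -/
import Mathlib

section
/- Let U ∈ 𝔖_F(𝕊_1^+) with F ∈ L^∞(𝕊_1^+). Then for almost every r ∈ (0,1), the function r ↦ H(U,r) is differentiable at r and H′(U,r) = (4/r)·I(U,r). -/
/- Formalization of results from "The structure of the singular set in the thin obstacle
problem for degenerate parabolic equations" by Banerjee, Danielli, Garofalo, Petrosyan.

Points of ℝ^{n+1} are written X = (x,y) with x : Fin n → ℝ and y : ℝ; functions of
space-time are `U : (Fin n → ℝ) → ℝ → ℝ → ℝ`, with `U x y t`. -/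

noncomputable section

open MeasureTheory Filter Topology

/-- Functions on ℝⁿ × ℝ × ℝ, written `U x y t` for `X = (x,y)` and time `t`. -/
abbrev Fn (n : ℕ) := (Fin n → ℝ) → ℝ → ℝ → ℝ

/-- Space-time points `(x, y, t)`. -/
abbrev Pt (n : ℕ) := (Fin n → ℝ) × ℝ × ℝ

/-- Partial derivative in the direction of the i-th thin coordinate. -/
def pdx {n : ℕ} (i : Fin n) (U : Fn n) (x : Fin n → ℝ) (y t : ℝ) : ℝ :=
  fderiv ℝ (fun x' => U x' y t) x (Pi.single i 1)

/-- Partial derivative in the extension variable y. -/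
def pdy {n : ℕ} (U : Fn n) (x : Fin n → ℝ) (y t : ℝ) : ℝ :=
  deriv (fun y' => U x y' t) y

/-- Time derivative. -/
def pdt {n : ℕ} (U : Fn n) (x : Fin n → ℝ) (y t : ℝ) : ℝ :=
  deriv (fun t' => U x y t') t

/-- Squared norm |∇U|² of the full spatial gradient. -/
def gradSq {n : ℕ} (U : Fn n) (x : Fin n → ℝ) (y t : ℝ) : ℝ :=
  (∑ i, (pdx i U x y t) ^ 2) + (pdy U x y t) ^ 2

/-- |∇V − ∇W|². -/
def gradDiffSq {n : ℕ} (V W : Fn n) (x : Fin n → ℝ) (y t : ℝ) : ℝ :=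
  (∑ i, (pdx i V x y t - pdx i W x y t) ^ 2) + (pdy V x y t - pdy W x y t) ^ 2

/-- The generator Z f = ⟨X, ∇f⟩ + 2 t ∂ₜ f of the parabolic dilations. -/
def Zop {n : ℕ} (U : Fn n) (x : Fin n → ℝ) (y t : ℝ) : ℝ :=
  (∑ i, x i * pdx i U x y t) + y * pdy U x y t + 2 * t * pdt U x y t

/-- Laplacian in the x variables only. -/
def lapx {n : ℕ} (U : Fn n) (x : Fin n → ℝ) (y t : ℝ) : ℝ :=
  ∑ i, pdx i (fun x' y' t' => pdx i U x' y' t') x y t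

/-- Second derivative in y. -/
def pdyy {n : ℕ} (U : Fn n) (x : Fin n → ℝ) (y t : ℝ) : ℝ :=
  pdy (fun x' y' t' => pdy U x' y' t') x y t

/-- Full spatial Laplacian in the variables X = (x,y). -/
def lapFull {n : ℕ} (U : Fn n) (x : Fin n → ℝ) (y t : ℝ) : ℝ :=
  lapx U x y t + pdyy U x y t

/-- |X|² for X = (x,y). -/
def nsq {n : ℕ} (x : Fin n → ℝ) (y : ℝ) : ℝ := (∑ i, (x i) ^ 2) + y ^ 2

/-- The backward Neumann fundamental solution Ḡ_a(X,t), for t < 0. -/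
def Gbar (n : ℕ) (a : ℝ) (x : Fin n → ℝ) (y t : ℝ) : ℝ :=
  (4 * Real.pi) ^ (-(n : ℝ) / 2) / ((2:ℝ) ^ a * Real.Gamma ((a + 1) / 2)) *
    |t| ^ (-((n : ℝ) + a + 1) / 2) * Real.exp (-(nsq x y) / (4 * |t|))

/-- The half-strip 𝕊_r⁺ = ℝ^{n+1}_+ × (−r², 0]. -/
def Splus (n : ℕ) (r : ℝ) : Set (Pt n) :=
  {p | 0 < p.2.1 ∧ p.2.2 ∈ Set.Ioc (-(r ^ 2)) 0}

/-- The Gaussian weight Ḡ_a(X,t) yᵃ. -/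
def wgt (n : ℕ) (a : ℝ) (p : Pt n) : ℝ :=
  Gbar n a p.1 p.2.1 p.2.2 * p.2.1 ^ a

/-- The height function H(U,r). -/
def Hfn (n : ℕ) (a : ℝ) (U : Fn n) (r : ℝ) : ℝ :=
  (1 / r ^ 2) * ∫ p in Splus n r, (U p.1 p.2.1 p.2.2) ^ 2 * wgt n a p

/-- The energy D(U,r). -/
def Dfn (n : ℕ) (a : ℝ) (U : Fn n) (r : ℝ) : ℝ :=
  (1 / r ^ 2) * ∫ p in Splus n r, |p.2.2| * gradSq U p.1 p.2.1 p.2.2 * wgt n a p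

/-- The total energy I(U,r). -/
def Ifn (n : ℕ) (a : ℝ) (U : Fn n) (r : ℝ) : ℝ :=
  (1 / (2 * r ^ 2)) * ∫ p in Splus n r, U p.1 p.2.1 p.2.2 * Zop U p.1 p.2.1 p.2.2 * wgt n a p

/-- The set of thin points in S₁ where both U and its weighted normal derivative
∂_yᵃ U vanish.  The extended free boundary Γ_*(U) is its boundary in S₁. -/
def ZeroSet (n : ℕ) (a : ℝ) (U : Fn n) : Set ((Fin n → ℝ) × ℝ) :=
  {q | q.2 ∈ Set.Ioc (-1 : ℝ) 0 ∧ U q.1 0 q.2 = 0 ∧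
    Tendsto (fun y => y ^ a * pdy U q.1 y q.2) (𝓝[>] (0 : ℝ)) (𝓝 0)}

/-- The Signorini class 𝔖_F(𝕊₁⁺). -/
structure SignoriniMem (n : ℕ) (a : ℝ) (F U : Fn n) : Prop where
  /-- continuity up to the thin space -/
  cont : ContinuousOn (fun p : Pt n => U p.1 p.2.1 p.2.2)
    {p : Pt n | 0 ≤ p.2.1 ∧ p.2.2 ∈ Set.Ioc (-1 : ℝ) 0}
  /-- bounded support in the space variables -/
  bddSupp : ∃ R > (0:ℝ), ∀ x y t, R ^ 2 ≤ nsq x y → U x y t = 0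
  /-- smoothness in {y > 0} -/
  smooth : ∀ x y t, 0 < y → t ∈ Set.Ioc (-1 : ℝ) 0 →
    ContDiffAt ℝ (⊤ : ℕ∞) (fun p : Pt n => U p.1 p.2.1 p.2.2) (x, y, t)
  /-- the equation yᵃ ∂ₜU = div(yᵃ ∇U) + yᵃ F holds classically in {y > 0} -/
  pde : ∀ x y t, 0 < y → t ∈ Set.Ioc (-1 : ℝ) 0 →
    pdt U x y t = lapFull U x y t + (a / y) * pdy U x y t + F x y t
  /-- ∇ₓU extends parabolically Hölder continuously up to {y = 0} -/
  holderX : ∃ α > (0:ℝ), ∃ C : ℝ, ∀ i : Fin n, ∀ x y t x' y' t',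
    0 < y → 0 < y' → t ∈ Set.Ioc (-1 : ℝ) 0 → t' ∈ Set.Ioc (-1 : ℝ) 0 →
    |pdx i U x y t - pdx i U x' y' t'| ≤
      C * ((∑ j, (x j - x' j) ^ 2) + (y - y') ^ 2 + |t - t'|) ^ (α / 2)
  /-- yᵃ ∂_y U extends parabolically Hölder continuously up to {y = 0} -/
  holderY : ∃ α > (0:ℝ), ∃ C : ℝ, ∀ x y t x' y' t',
    0 < y → 0 < y' → t ∈ Set.Ioc (-1 : ℝ) 0 → t' ∈ Set.Ioc (-1 : ℝ) 0 →
    |y ^ a * pdy U x y t - y' ^ a * pdy U x' y' t'| ≤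
      C * ((∑ j, (x j - x' j) ^ 2) + (y - y') ^ 2 + |t - t'|) ^ (α / 2)
  /-- ∂ₜU ∈ L^∞(𝕊₁⁺) -/
  bddTime : ∃ M : ℝ, ∀ x y t, 0 < y → t ∈ Set.Ioc (-1 : ℝ) 0 → |pdt U x y t| ≤ M
  /-- yᵃ |∇ ∂ₓᵢ U|² integrable on 𝕊₁⁺ -/
  intXX : ∀ i : Fin n, IntegrableOn
    (fun p : Pt n => p.2.1 ^ a * gradSq (fun x y t => pdx i U x y t) p.1 p.2.1 p.2.2)
    (Splus n 1)
  /-- y^{−a} (∂_y(yᵃ ∂_y U))² integrable on 𝕊₁⁺ -/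
  intYY : IntegrableOn
    (fun p : Pt n => p.2.1 ^ (-a) *
      (pdy (fun x y t => y ^ a * pdy U x y t) p.1 p.2.1 p.2.2) ^ 2) (Splus n 1)
  /-- U ≥ 0 on the thin space -/
  nonneg : ∀ x, ∀ t ∈ Set.Ioc (-1 : ℝ) 0, 0 ≤ U x 0 t
  /-- the Signorini complementarity conditions on the thin space -/
  signorini : ∀ x, ∀ t ∈ Set.Ioc (-1 : ℝ) 0, ∃ L ≤ (0:ℝ),
    Tendsto (fun y => y ^ a * pdy U x y t) (𝓝[>] (0 : ℝ)) (𝓝 L) ∧ U x 0 t * L = 0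
  /-- (0,0) belongs to the extended free boundary Γ_*(U) -/
  originFB : (0, 0) ∈ closure (ZeroSet n a U) ∧
    (0, 0) ∈ closure ({q : (Fin n → ℝ) × ℝ | q.2 ∈ Set.Ioc (-1 : ℝ) 0} \ ZeroSet n a U)

/-- The growth bound |F(X,t)| ≤ C_ℓ |(X,t)|^{ℓ−2} on 𝕊₁⁺. -/
def FGrowth (n : ℕ) (F : Fn n) (l Cl : ℝ) : Prop :=
  ∀ x y t, 0 < y → t ∈ Set.Ioc (-1 : ℝ) 0 →
    |F x y t| ≤ Cl * (nsq x y + |t|) ^ ((l - 2) / 2)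

/-- The growth bound |∇_X F(X,t)| ≤ C_ℓ |(X,t)|^{ℓ−3} on 𝔹_{1/2}⁺ × (−1/4, 0]. -/
def FGradGrowth (n : ℕ) (F : Fn n) (l Cl : ℝ) : Prop :=
  ∀ x y t, 0 < y → nsq x y < (1/2 : ℝ) ^ 2 → t ∈ Set.Ioc (-(1/4 : ℝ)) 0 →
    Real.sqrt (gradSq F x y t) ≤ Cl * (nsq x y + |t|) ^ ((l - 3) / 2)

/-- The growth bound |∂ₜF(X,t)| ≤ C_ℓ |(X,t)|^{ℓ−4} on 𝔹_{1/2}⁺ × (−1/4, 0]. -/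
def FTimeGrowth (n : ℕ) (F : Fn n) (l Cl : ℝ) : Prop :=
  ∀ x y t, 0 < y → nsq x y < (1/2 : ℝ) ^ 2 → t ∈ Set.Ioc (-(1/4 : ℝ)) 0 →
    |pdt F x y t| ≤ Cl * (nsq x y + |t|) ^ ((l - 4) / 2)

/-- r ↦ log max{H(U,r), r^{2ℓ−2+2σ}}. -/
def logMaxH (n : ℕ) (a : ℝ) (U : Fn n) (l σ : ℝ) (r : ℝ) : ℝ :=
  Real.log (max (Hfn n a U r) (r ^ (2 * l - 2 + 2 * σ)))

/-- The set of radii in (0,1) where `logMaxH` is differentiable (it is locally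
Lipschitz, hence this set has full measure). -/
def diffSet (n : ℕ) (a : ℝ) (U : Fn n) (l σ : ℝ) : Set ℝ :=
  {r | r ∈ Set.Ioo (0 : ℝ) 1 ∧ DifferentiableAt ℝ (logMaxH n a U l σ) r}

/-- The truncated Almgren–Poon frequency Φ_{ℓ,σ}(U,·), with constant C. -/
def Phi (n : ℕ) (a : ℝ) (U : Fn n) (l σ C : ℝ) (r : ℝ) : ℝ :=
  (1/2) * r * Real.exp (C * r ^ (1 - σ)) * deriv (logMaxH n a U l σ) r
    + 2 * (Real.exp (C * r ^ (1 - σ)) - 1)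

/-- The parabolic Almgren rescalings U_r. -/
def rescale (n : ℕ) (a : ℝ) (U : Fn n) (r : ℝ) : Fn n :=
  fun x y t => U (r • x) (r * y) (r ^ 2 * t) / Real.sqrt (Hfn n a U r)

/-- The Weiss functional 𝒲_κ(U,r). -/
def Wfn (n : ℕ) (a : ℝ) (U : Fn n) (κ r : ℝ) : ℝ :=
  r ^ (-(2 * κ)) * (Dfn n a U r - κ / 2 * Hfn n a U r)

/-- The Monneau functional M_κ(U,p_κ,r). -/
def Mfn (n : ℕ) (a : ℝ) (U pk : Fn n) (κ r : ℝ) : ℝ :=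
  r ^ (-(2 * κ + 2)) *
    ∫ p in Splus n r, (U p.1 p.2.1 p.2.2 - pk p.1 p.2.1 p.2.2) ^ 2 * wgt n a p

/-- Polynomial functions of (x,t). -/
def IsPolyFun2 (n : ℕ) (q : (Fin n → ℝ) → ℝ → ℝ) : Prop :=
  ∃ P : MvPolynomial (Fin (n + 1)) ℝ, ∀ x t, q x t = MvPolynomial.eval (Fin.snoc x t) P

/-- Polynomial functions of (x,y,t). -/
def IsPolyFun3 (n : ℕ) (q : Fn n) : Prop :=
  ∃ P : MvPolynomial (Fin (n + 2)) ℝ, ∀ x y t,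
    q x y t = MvPolynomial.eval (Fin.snoc (Fin.snoc x y) t) P

/-- The class 𝒫_κ⁺ of parabolically κ-homogeneous, even in y, a-caloric polynomials
which are nonnegative on the thin space. -/
def Pkappa (n : ℕ) (a κ : ℝ) (p : Fn n) : Prop :=
  IsPolyFun3 n p ∧
  (∀ lam > (0:ℝ), ∀ x y t, p (lam • x) (lam * y) (lam ^ 2 * t) = lam ^ κ * p x y t) ∧
  (∀ x y t, p x (-y) t = p x y t) ∧
  (∀ x t, 0 ≤ p x 0 t) ∧
  (∀ x y t, y ≠ 0 →
    pdt p x y t - lapx p x y t - pdyy p x y t - (a / y) * pdy p x y t = 0)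

/-- The coincidence set Λ(U) ⊆ S₁. -/
def Lam (n : ℕ) (U : Fn n) : Set ((Fin n → ℝ) × ℝ) :=
  {q | q.2 ∈ Set.Ioc (-1 : ℝ) 0 ∧ U q.1 0 q.2 = 0}

/-- The thin parabolic cylinder Q_r = B_r × (−r²,0]. -/
def Qthin (n : ℕ) (r : ℝ) : Set ((Fin n → ℝ) × ℝ) :=
  {q | (∑ i, (q.1 i) ^ 2) < r ^ 2 ∧ q.2 ∈ Set.Ioc (-(r ^ 2)) 0}

/-- The modified Bessel function of the first kind I_ν(z). -/
def besselI (ν z : ℝ) : ℝ :=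
  ∑' k : ℕ, (z / 2) ^ (ν + 2 * (k : ℝ)) /
    (Real.Gamma ((k : ℝ) + 1) * Real.Gamma ((k : ℝ) + ν + 1))

/-- The Bessel heat kernel p^{(a)}(y,η,t). -/
def pker (a y η t : ℝ) : ℝ :=
  (2 * t) ^ (-(a + 1) / 2) * (y * η / (2 * t)) ^ ((1 - a) / 2) *
    besselI ((a - 1) / 2) (y * η / (2 * t)) * Real.exp (-(y ^ 2 + η ^ 2) / (4 * t))


/-- The parabolic dilation `(X,t) ↦ (rX, r²t)`. -/
def dilate {n : ℕ} (r : ℝ) (p : Pt n) : Pt n := (r • p.1, r * p.2.1, r ^ 2 * p.2.2)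

lemma measurableSet_Splus (n : ℕ) (r : ℝ) : MeasurableSet (Splus n r) := by
  unfold Splus
  exact (measurableSet_lt measurable_const
    (by fun_prop : Measurable fun p : Pt n => p.2.1)).inter
    (measurableSet_Ioc.preimage (by fun_prop : Measurable fun p : Pt n => p.2.2))

lemma measurable_wgt (n : ℕ) (a : ℝ) : Measurable (wgt n a) := by
  unfold wgt Gbar nsq
  fun_prop

lemma integrable_exp_neg_mul_sum_sq (n : ℕ) {b : ℝ} (hb : 0 < b) :
    Integrable (fun x : Fin n → ℝ => Real.exp (-b * ∑ i, x i ^ 2)) := by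
  simp_rw [Finset.mul_sum, Real.exp_sum]
  exact Integrable.fintype_prod (f := fun _ s => Real.exp (-b * s ^ 2))
    fun _ => integrable_exp_neg_mul_sq hb

lemma integral_exp_neg_mul_sum_sq (n : ℕ) (b : ℝ) :
    ∫ x : Fin n → ℝ, Real.exp (-b * ∑ i, x i ^ 2) = √(Real.pi / b) ^ n := by
  simp_rw [Finset.mul_sum, Real.exp_sum]
  rw [integral_fintype_prod_volume_eq_pow (fun s : ℝ => Real.exp (-b * s ^ 2)),
    integral_gaussian, Fintype.card_fin]

lemma wgt_eq (n : ℕ) (a : ℝ) (x : Fin n → ℝ) (y t : ℝ) :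
    wgt n a (x, y, t) =
      (4 * Real.pi) ^ (-(n : ℝ) / 2) / ((2:ℝ) ^ a * Real.Gamma ((a + 1) / 2)) *
        |t| ^ (-((n : ℝ) + a + 1) / 2) *
        (Real.exp (-(1 / (4 * |t|)) * ∑ i, x i ^ 2) *
          (y ^ a * Real.exp (-(1 / (4 * |t|)) * y ^ 2))) := by
  have h : Real.exp (-(nsq x y) / (4 * |t|)) =
      Real.exp (-(1 / (4 * |t|)) * ∑ i, x i ^ 2) * Real.exp (-(1 / (4 * |t|)) * y ^ 2) := by
    rw [← Real.exp_add, nsq]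
    congr 1
    ring
  simp only [wgt, Gbar, h]
  ring

lemma wgt_nonneg {n : ℕ} {a : ℝ} (ha : -1 < a) {p : Pt n} (hp : 0 < p.2.1) :
    0 ≤ wgt n a p := by
  have := Real.Gamma_pos_of_pos (show 0 < (a + 1) / 2 by linarith)
  unfold wgt Gbar
  positivity

/-- The powers of `s = |t|` in the mass of the Gaussian weight on a time slice cancel. -/
lemma sqrt_pow_mul_rpow_eq (n : ℕ) (a : ℝ) {s : ℝ} (hs : 0 < s) :
    s ^ (-((n : ℝ) + a + 1) / 2) *
      (√(Real.pi / (1 / (4 * s))) ^ n * (1 / (4 * s)) ^ (-(a + 1) / 2)) =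
    √(4 * Real.pi) ^ n * 4 ^ ((a + 1) / 2) := by
  have h1 : Real.pi / (1 / (4 * s)) = (4 * Real.pi) * s := by field_simp
  have h2 : (1 / (4 * s)) ^ (-(a + 1) / 2) = 4 ^ ((a + 1) / 2) * s ^ ((a + 1) / 2) := by
    rw [one_div, Real.inv_rpow (by positivity), ← Real.rpow_neg (by positivity),
      Real.mul_rpow (by norm_num) hs.le]
    congr 2 <;> ring
  have h3 : √s ^ n = s ^ ((n : ℝ) / 2) := by
    rw [Real.sqrt_eq_rpow, ← Real.rpow_natCast, ← Real.rpow_mul hs.le]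
    congr 1
    ring
  have h4 : s ^ (-((n : ℝ) + a + 1) / 2) * (s ^ ((n : ℝ) / 2) * s ^ ((a + 1) / 2)) = 1 := by
    rw [← Real.rpow_add hs, ← Real.rpow_add hs]
    ring_nf
    exact Real.rpow_zero s
  rw [h1, h2, Real.sqrt_mul (by positivity), mul_pow, h3]
  linear_combination √(4 * Real.pi) ^ n * 4 ^ ((a + 1) / 2) * h4

lemma integrableOn_wgt (n : ℕ) {a : ℝ} (ha : -1 < a) :
    IntegrableOn (wgt n a) (Splus n 1) := by
  have hS : Splus n 1 = Set.univ ×ˢ (Set.Ioi 0 ×ˢ Set.Ioc (-1) 0) := by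
    ext p
    simp [Splus]
  have hne : ∀ᵐ t ∂(volume.restrict (Set.Ioc (-1 : ℝ) 0)), 0 < |t| := by
    filter_upwards [ae_restrict_of_ae (Measure.ae_ne volume (0 : ℝ))] with t ht
    exact abs_pos.mpr ht
  have hne' : ∀ᵐ q ∂((volume.restrict (Set.Ioi (0 : ℝ))).prod
      (volume.restrict (Set.Ioc (-1 : ℝ) 0))), 0 < q.1 ∧ 0 < |q.2| := by
    filter_upwards [Measure.quasiMeasurePreserving_fst.ae (ae_restrict_mem measurableSet_Ioi),
      Measure.quasiMeasurePreserving_snd.ae hne] with q h1 h2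
    exact ⟨h1, h2⟩
  set c := (4 * Real.pi) ^ (-(n : ℝ) / 2) / ((2:ℝ) ^ a * Real.Gamma ((a + 1) / 2))
  rw [IntegrableOn, hS, Measure.volume_eq_prod, ← Measure.prod_restrict, Measure.restrict_univ,
    Measure.volume_eq_prod, ← Measure.prod_restrict,
    integrable_prod_iff' (measurable_wgt n a).aestronglyMeasurable]
  constructor
  · filter_upwards [hne'] with q hq
    have hb : 0 < 1 / (4 * |q.2|) := by have := hq.2; positivity
    have := (((integrable_exp_neg_mul_sum_sq n hb).mul_const
      (q.1 ^ a * Real.exp (-(1 / (4 * |q.2|)) * q.1 ^ 2))).const_mul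
        (c * |q.2| ^ (-((n : ℝ) + a + 1) / 2)))
    exact this.congr (Eventually.of_forall fun x => (wgt_eq n a x q.1 q.2).symm)
  · have hcong : (fun q : ℝ × ℝ => ∫ x : Fin n → ℝ, ‖wgt n a (x, q)‖) =ᵐ[
        (volume.restrict (Set.Ioi (0 : ℝ))).prod (volume.restrict (Set.Ioc (-1 : ℝ) 0))]
        fun q => c * |q.2| ^ (-((n : ℝ) + a + 1) / 2) * (√(Real.pi / (1 / (4 * |q.2|))) ^ n *
          (q.1 ^ a * Real.exp (-(1 / (4 * |q.2|)) * q.1 ^ 2))) := by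
      filter_upwards [hne'] with q hq
      rw [← integral_exp_neg_mul_sum_sq, ← integral_mul_const, ← integral_const_mul]
      refine integral_congr_ae (Eventually.of_forall fun x => ?_)
      simp only
      rw [Real.norm_of_nonneg (wgt_nonneg ha hq.1)]
      exact wgt_eq n a x q.1 q.2
    rw [integrable_congr hcong, integrable_prod_iff' (by fun_prop)]
    constructor
    · filter_upwards [hne] with t ht
      exact ((integrableOn_rpow_mul_exp_neg_mul_sq (by positivity) ha).const_mul _).const_mul _
    · have hconst : (fun t : ℝ => ∫ y in Set.Ioi (0 : ℝ),
          ‖c * |t| ^ (-((n : ℝ) + a + 1) / 2) * (√(Real.pi / (1 / (4 * |t|))) ^ n *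
            (y ^ a * Real.exp (-(1 / (4 * |t|)) * y ^ 2)))‖) =ᵐ[
          volume.restrict (Set.Ioc (-1 : ℝ) 0)]
          fun _ => |c| * (√(4 * Real.pi) ^ n * 4 ^ ((a + 1) / 2)) *
            (1 / 2 * Real.Gamma ((a + 1) / 2)) := by
        filter_upwards [hne] with t ht
        have h1 : ∀ y ∈ Set.Ioi (0 : ℝ),
            ‖c * |t| ^ (-((n : ℝ) + a + 1) / 2) * (√(Real.pi / (1 / (4 * |t|))) ^ n *
              (y ^ a * Real.exp (-(1 / (4 * |t|)) * y ^ 2)))‖ =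
            |c| * |t| ^ (-((n : ℝ) + a + 1) / 2) * √(Real.pi / (1 / (4 * |t|))) ^ n *
              (y ^ a * Real.exp (-(1 / (4 * |t|)) * y ^ (2 : ℝ))) := by
          intro y hy
          have hy' : 0 < y := hy
          rw [mul_assoc c, norm_mul, Real.norm_eq_abs c, Real.norm_of_nonneg (by positivity),
            Real.rpow_two]
          ring
        rw [setIntegral_congr_fun measurableSet_Ioi h1, integral_const_mul,
          integral_rpow_mul_exp_neg_mul_rpow two_pos ha (by positivity),
          ← sqrt_pow_mul_rpow_eq n a ht]
        ring
      rw [integrable_congr hconst]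
      exact integrable_const _

lemma continuous_dilate {n : ℕ} (r : ℝ) : Continuous (dilate r : Pt n → Pt n) := by
  unfold dilate
  fun_prop

lemma dilate_mem_Splus_iff {n : ℕ} {r : ℝ} (hr : 0 < r) (p : Pt n) :
    dilate r p ∈ Splus n r ↔ p ∈ Splus n 1 := by
  have h2 : 0 < r ^ 2 := by positivity
  simp only [dilate, Splus, Set.mem_ofPred_eq, Set.mem_Ioc, mul_pos_iff_of_pos_left hr,
    one_pow]
  refine and_congr Iff.rfl (and_congr ⟨fun h => ?_, fun h => ?_⟩ ⟨fun h => ?_, fun h => ?_⟩) <;>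
    nlinarith

lemma map_dilate_volume (n : ℕ) {r : ℝ} (hr : 0 < r) :
    Measure.map (dilate r) (volume : Measure (Pt n)) =
      ENNReal.ofReal ((r ^ (n + 3))⁻¹) • volume := by
  have h1 : Measure.map (fun x : Fin n → ℝ => r • x) volume =
      ENNReal.ofReal ((r ^ n)⁻¹) • volume := by
    rw [Measure.map_addHaar_smul volume hr.ne', abs_of_pos (by positivity)]
    simp
  have h2 : ∀ s : ℝ, 0 < s → Measure.map (fun x : ℝ => s * x) volume =
      ENNReal.ofReal s⁻¹ • volume := by
    intro s hs
    rw [Real.map_volume_mul_left hs.ne', abs_of_pos (by positivity)]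
  have hd : (dilate r : Pt n → Pt n) =
      Prod.map (fun x => r • x) (Prod.map (fun y => r * y) fun t => r ^ 2 * t) := rfl
  rw [hd, Measure.volume_eq_prod, ← Measure.map_prod_map _ _ (by fun_prop) (by fun_prop),
    Measure.volume_eq_prod, ← Measure.map_prod_map _ _ (by fun_prop) (by fun_prop),
    h1, h2 r hr, h2 (r ^ 2) (by positivity)]
  simp only [Measure.prod_smul_left, Measure.prod_smul_right, smul_smul]
  rw [← ENNReal.ofReal_mul (by positivity), ← ENNReal.ofReal_mul (by positivity)]
  congr 2
  field_simp
  ring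

lemma integral_comp_dilate (n : ℕ) {r : ℝ} (hr : 0 < r) (g : Pt n → ℝ) :
    ∫ p, g (dilate r p) = (r ^ (n + 3))⁻¹ * ∫ p, g p := by
  have hemb : MeasurableEmbedding (dilate r : Pt n → Pt n) := by
    refine (continuous_dilate r).measurableEmbedding fun p q h => ?_
    simp only [dilate, Prod.mk.injEq] at h
    obtain ⟨h1, h2, h3⟩ := h
    exact Prod.ext (smul_right_injective _ hr.ne' h1)
      (Prod.ext (mul_left_cancel₀ hr.ne' h2) (mul_left_cancel₀ (pow_ne_zero 2 hr.ne') h3))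
  rw [← hemb.integral_map, map_dilate_volume n hr, integral_smul_measure,
    ENNReal.toReal_ofReal (by positivity), smul_eq_mul]

lemma wgt_dilate {n : ℕ} {a r : ℝ} (hr : 0 < r) {p : Pt n} (hp : 0 < p.2.1) :
    wgt n a (dilate r p) = (r ^ (n + 1))⁻¹ * wgt n a p := by
  obtain ⟨x, y, t⟩ := p
  simp only at hp
  have hexp : -(nsq (r • x) (r * y)) / (4 * |r ^ 2 * t|) = -(nsq x y) / (4 * |t|) := by
    have : nsq (r • x) (r * y) = r ^ 2 * nsq x y := by
      simp [nsq, mul_pow, Finset.mul_sum, mul_add]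
    rw [this, abs_mul, abs_of_pos (by positivity : 0 < r ^ 2), neg_div, neg_div,
      mul_left_comm, mul_div_mul_left _ _ (by positivity)]
  have hpow : (r ^ 2) ^ (-((n : ℝ) + a + 1) / 2) * r ^ a = (r ^ (n + 1))⁻¹ := by
    rw [← Real.rpow_two, ← Real.rpow_mul hr.le, ← Real.rpow_add hr, ← Real.rpow_natCast,
      ← Real.rpow_neg hr.le]
    congr 1
    push_cast
    ring
  simp only [wgt, Gbar, dilate, hexp]
  rw [abs_mul, abs_of_pos (by positivity : 0 < r ^ 2), Real.mul_rpow (by positivity) (abs_nonneg t), Real.mul_rpow hr.le hp.le, ← hpow]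
  ring

lemma integral_Splus_eq {n : ℕ} {a r : ℝ} (hr : 0 < r) (f : Pt n → ℝ) :
    ∫ p in Splus n r, f p * wgt n a p =
      r ^ 2 * ∫ p in Splus n 1, f (dilate r p) * wgt n a p := by
  rw [← integral_indicator (measurableSet_Splus n r),
    ← integral_indicator (measurableSet_Splus n 1)]
  have h := integral_comp_dilate n hr ((Splus n r).indicator fun p => f p * wgt n a p)
  have h2 : ∀ p, (Splus n r).indicator (fun p => f p * wgt n a p) (dilate r p) =
      (r ^ (n + 1))⁻¹ * (Splus n 1).indicator (fun p => f (dilate r p) * wgt n a p) p := by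
    intro p
    by_cases hp : p ∈ Splus n 1
    · rw [Set.indicator_of_mem ((dilate_mem_Splus_iff hr p).2 hp), Set.indicator_of_mem hp,
        wgt_dilate hr hp.1]
      ring
    · rw [Set.indicator_of_notMem (mt (dilate_mem_Splus_iff hr p).1 hp),
        Set.indicator_of_notMem hp, mul_zero]
  simp_rw [h2] at h
  rw [integral_const_mul] at h
  field_simp at h
  have hpos : r ^ (n + 1) ≠ 0 := by positivity
  apply mul_left_cancel₀ hpos
  rw [← h]
  ring

lemma abs_coord_le_of_nsq_le {n : ℕ} {x : Fin n → ℝ} {y R : ℝ} (hR : 0 ≤ R)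
    (h : nsq x y ≤ R ^ 2) (i : Fin n) : |x i| ≤ R := by
  refine abs_le_of_sq_le_sq ?_ hR
  have := Finset.single_le_sum (f := fun i => x i ^ 2) (fun i _ => sq_nonneg _)
    (Finset.mem_univ i)
  simp only [nsq] at h
  nlinarith [sq_nonneg y]

lemma abs_snd_le_of_nsq_le {n : ℕ} {x : Fin n → ℝ} {y R : ℝ} (hR : 0 ≤ R)
    (h : nsq x y ≤ R ^ 2) : |y| ≤ R := by
  refine abs_le_of_sq_le_sq ?_ hR
  have := Finset.sum_nonneg (s := Finset.univ) (fun i _ => sq_nonneg (x i))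
  simp only [nsq] at h
  linarith

lemma Zop_eq_fderiv {n : ℕ} {U : Fn n} {x : Fin n → ℝ} {y t : ℝ}
    (h : DifferentiableAt ℝ (fun p : Pt n => U p.1 p.2.1 p.2.2) (x, y, t)) :
    Zop U x y t = fderiv ℝ (fun p : Pt n => U p.1 p.2.1 p.2.2) (x, y, t) (x, y, 2 * t) := by
  set L := fderiv ℝ (fun p : Pt n => U p.1 p.2.1 p.2.2) (x, y, t) with hL
  have hx : ∀ i, pdx i U x y t = L (Pi.single i 1, 0, 0) := by
    intro i
    have hg : HasFDerivAt (fun x' : Fin n → ℝ => ((x', y, t) : Pt n))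
        (ContinuousLinearMap.inl ℝ (Fin n → ℝ) (ℝ × ℝ)) x := hasFDerivAt_prodMk_left x (y, t)
    have := (h.hasFDerivAt.comp x hg).fderiv
    simp only [Function.comp_def] at this
    simp only [pdx, this, hL]
    rfl
  have hy : pdy U x y t = L (0, 1, 0) := by
    have hg : HasDerivAt (fun y' : ℝ => ((x, y', t) : Pt n)) (0, 1, 0) y :=
      (hasDerivAt_const y x).prodMk ((hasDerivAt_id y).prodMk (hasDerivAt_const y t))
    exact (h.hasFDerivAt.comp_hasDerivAt y hg).deriv
  have ht : pdt U x y t = L (0, 0, 1) := by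
    have hg : HasDerivAt (fun t' : ℝ => ((x, y, t') : Pt n)) (0, 0, 1) t :=
      (hasDerivAt_const t x).prodMk ((hasDerivAt_const t y).prodMk (hasDerivAt_id t))
    exact (h.hasFDerivAt.comp_hasDerivAt t hg).deriv
  have hdec : ((x, y, 2 * t) : Pt n) =
      (∑ i, x i • ((Pi.single i 1, 0, 0) : Pt n)) + y • (0, 1, 0) + (2 * t) • (0, 0, 1) := by
    have h1 : (∑ i, x i • ((Pi.single i 1, 0, 0) : Pt n)) = (x, 0, 0) := by
      refine Prod.ext ?_ (Prod.ext ?_ ?_)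
      · ext j
        simp [Prod.fst_sum, Finset.sum_apply, Pi.single_apply]
      · simp [Prod.snd_sum]
      · simp [Prod.snd_sum]
    rw [h1]
    simp
  simp only [Zop, hx, hy, ht]
  rw [hdec, map_add, map_add, map_sum, map_smul, map_smul]
  simp only [map_smul, smul_eq_mul]

lemma hasDerivAt_comp_dilate {n : ℕ} {U : Fn n} {r : ℝ} (hr : 0 < r) (p : Pt n)
    (h : DifferentiableAt ℝ (fun p : Pt n => U p.1 p.2.1 p.2.2) (dilate r p)) :
    HasDerivAt (fun s => U (dilate s p).1 (dilate s p).2.1 (dilate s p).2.2)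
      (Zop U (dilate r p).1 (dilate r p).2.1 (dilate r p).2.2 / r) r := by
  have hg : HasDerivAt (fun s => dilate s p) (p.1, p.2.1, 2 * r * p.2.2) r := by
    have h1 : HasDerivAt (fun s : ℝ => s • p.1) p.1 r := by
      simpa using (hasDerivAt_id r).smul_const p.1
    have h2 : HasDerivAt (fun s : ℝ => s * p.2.1) p.2.1 r := by
      simpa using (hasDerivAt_id r).mul_const p.2.1
    have h3 : HasDerivAt (fun s : ℝ => s ^ 2 * p.2.2) (2 * r * p.2.2) r := by
      simpa using (hasDerivAt_pow 2 r).mul_const p.2.2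
    exact h1.prodMk (h2.prodMk h3)
  have hZ : Zop U (dilate r p).1 (dilate r p).2.1 (dilate r p).2.2 / r =
      fderiv ℝ (fun p : Pt n => U p.1 p.2.1 p.2.2) (dilate r p) (p.1, p.2.1, 2 * r * p.2.2) := by
    have hZ' : Zop U (dilate r p).1 (dilate r p).2.1 (dilate r p).2.2 = _ := Zop_eq_fderiv h
    rw [hZ', div_eq_inv_mul, ← smul_eq_mul, ← map_smul]
    congr 1
    refine Prod.ext ?_ (Prod.ext ?_ ?_)
    · simp [dilate, smul_smul, hr.ne']
    · simp [dilate, hr.ne']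
    · simp only [dilate, Prod.smul_snd, smul_eq_mul]
      field_simp
  rw [hZ]
  exact h.hasFDerivAt.comp_hasDerivAt r hg

namespace SignoriniMem

variable {n : ℕ} {a : ℝ} {F U : Fn n}

lemma differentiableAt (hU : SignoriniMem n a F U) {p : Pt n} (hp : p ∈ Splus n 1) :
    DifferentiableAt ℝ (fun p : Pt n => U p.1 p.2.1 p.2.2) p :=
  (hU.smooth p.1 p.2.1 p.2.2 hp.1 (by simpa using hp.2)).differentiableAt (by simp)

lemma continuousOn_mul_Zop (hU : SignoriniMem n a F U) :
    ContinuousOn (fun p : Pt n => U p.1 p.2.1 p.2.2 * Zop U p.1 p.2.1 p.2.2) (Splus n 1) := by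
  have hc : ContinuousOn (fun p : Pt n => U p.1 p.2.1 p.2.2 *
      fderiv ℝ (fun p : Pt n => U p.1 p.2.1 p.2.2) p (p.1, p.2.1, 2 * p.2.2)) (Splus n 1) := by
    intro p hp
    refine ContinuousAt.continuousWithinAt ?_
    have h1 : ContinuousAt (fderiv ℝ (fun p : Pt n => U p.1 p.2.1 p.2.2)) p :=
      ((hU.smooth p.1 p.2.1 p.2.2 hp.1 (by simpa using hp.2)).fderiv_right
        (m := 0) (by simp)).continuousAt
    exact (hU.differentiableAt hp).continuousAt.mul (h1.clm_apply (by fun_prop))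
  exact hc.congr fun p hp => by rw [Zop_eq_fderiv (hU.differentiableAt hp)]

/-- `U` is bounded on closed sub-strips. -/
lemma exists_abs_le (hU : SignoriniMem n a F U) {ρ : ℝ} (hρ : ρ ^ 2 < 1) :
    ∃ C, ∀ p : Pt n, p ∈ Splus n ρ → |U p.1 p.2.1 p.2.2| ≤ C := by
  obtain ⟨R, hR, hsupp⟩ := hU.bddSupp
  have hK : IsCompact (Set.Icc (fun _ : Fin n => -R) (fun _ => R) ×ˢ
      (Set.Icc (0 : ℝ) R ×ˢ Set.Icc (-(ρ ^ 2)) 0)) :=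
    isCompact_Icc.prod (isCompact_Icc.prod isCompact_Icc)
  have hcont : ContinuousOn (fun p : Pt n => U p.1 p.2.1 p.2.2)
      (Set.Icc (fun _ : Fin n => -R) (fun _ => R) ×ˢ
        (Set.Icc (0 : ℝ) R ×ˢ Set.Icc (-(ρ ^ 2)) 0)) :=
    hU.cont.mono fun p hp => ⟨hp.2.1.1, by linarith [hp.2.2.1], hp.2.2.2⟩
  obtain ⟨C, hC⟩ := hK.exists_bound_of_continuousOn hcont
  refine ⟨max C 0, fun p hp => ?_⟩
  rcases le_or_gt (R ^ 2) (nsq p.1 p.2.1) with h | h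
  · simp [hsupp _ _ p.2.2 h]
  · have hx := abs_coord_le_of_nsq_le hR.le h.le
    have hy := le_of_abs_le (abs_snd_le_of_nsq_le hR.le h.le)
    refine le_max_of_le_left (hC p ⟨⟨fun i => (abs_le.1 (hx i)).1, fun i => (abs_le.1 (hx i)).2⟩,
      ⟨hp.1.le, hy⟩, hp.2.1.le, hp.2.2⟩)

/-- `ZU` is bounded on the support of `U`. -/
lemma exists_abs_Zop_le (hU : SignoriniMem n a F U) (ha : a < 1) :
    ∃ C, 0 ≤ C ∧ ∀ p ∈ Splus n 1, U p.1 p.2.1 p.2.2 ≠ 0 →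
      |Zop U p.1 p.2.1 p.2.2| ≤ C := by
  obtain ⟨R, hR, hsupp⟩ := hU.bddSupp
  obtain ⟨α, hα, A, hA⟩ := hU.holderX
  obtain ⟨β, hβ, B, hB⟩ := hU.holderY
  obtain ⟨M, hM⟩ := hU.bddTime
  set A' := |A| * (5 * R ^ 2) ^ (α / 2)
  set B' := |B| * (5 * R ^ 2) ^ (β / 2)
  refine ⟨n * (R * A') + R ^ (1 - a) * B' + 2 * |M|, by positivity, ?_⟩
  rintro ⟨x, y, t⟩ ⟨hy0, ht⟩ hne
  simp only [one_pow] at hy0 ht hne ⊢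
  have h : nsq x y < R ^ 2 := by
    by_contra hcon
    exact hne (hsupp _ _ _ (not_lt.1 hcon))
  have hx := abs_coord_le_of_nsq_le hR.le h.le
  have hy := le_of_abs_le (abs_snd_le_of_nsq_le hR.le h.le)
  -- the gradient vanishes at the reference point `(0, 2R, t)` outside the support
  have hfar : ∀ x' y', R ≤ y' → U x' y' t = 0 := by
    intro x' y' hy'
    refine hsupp _ _ _ ?_
    have := Finset.sum_nonneg (s := Finset.univ) (fun i _ => sq_nonneg (x' i))
    simp only [nsq]
    nlinarith
  have hx0 : ∀ i, pdx i U 0 (2 * R) t = 0 := by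
    intro i
    have : (fun x' => U x' (2 * R) t) = fun _ => 0 :=
      funext fun x' => hfar x' (2 * R) (by linarith)
    simp [pdx, this]
  have hy0' : pdy U 0 (2 * R) t = 0 := by
    have : (fun y' => U 0 y' t) =ᶠ[𝓝 (2 * R)] fun _ => 0 := by
      filter_upwards [lt_mem_nhds (show R < 2 * R by linarith)] with y' hy'
      exact hfar 0 y' hy'.le
    simp [pdy, this.deriv_eq]
  have hD0 : 0 ≤ (∑ j, (x j - (0 : Fin n → ℝ) j) ^ 2) + (y - 2 * R) ^ 2 + |t - t| := by
    positivity
  have hD : (∑ j, (x j - (0 : Fin n → ℝ) j) ^ 2) + (y - 2 * R) ^ 2 + |t - t| ≤ 5 * R ^ 2 := by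
    simp only [nsq] at h
    simp only [Pi.zero_apply, sub_zero, sub_self, abs_zero]
    nlinarith [mul_pos hy0 hR]
  have hpx : ∀ i, |pdx i U x y t| ≤ A' := by
    intro i
    have := hA i x y t 0 (2 * R) t hy0 (by linarith) ht ht
    rw [hx0, sub_zero] at this
    refine this.trans (mul_le_mul (le_abs_self A) ?_ (by positivity) (abs_nonneg A))
    exact Real.rpow_le_rpow hD0 hD (by positivity)
  have hpy : |y ^ a * pdy U x y t| ≤ B' := by
    have := hB x y t 0 (2 * R) t hy0 (by linarith) ht ht
    rw [hy0', mul_zero, sub_zero] at this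
    refine this.trans (mul_le_mul (le_abs_self B) ?_ (by positivity) (abs_nonneg B))
    exact Real.rpow_le_rpow hD0 hD (by positivity)
  have h1 : |∑ i, x i * pdx i U x y t| ≤ n * (R * A') := by
    refine (Finset.abs_sum_le_sum_abs _ _).trans ?_
    have : ∀ i ∈ Finset.univ, |x i * pdx i U x y t| ≤ R * A' := by
      intro i _
      rw [abs_mul]
      exact mul_le_mul (hx i) (hpx i) (abs_nonneg _) hR.le
    simpa using Finset.sum_le_card_nsmul _ _ _ this
  have h2 : |y * pdy U x y t| ≤ R ^ (1 - a) * B' := by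
    have : y * pdy U x y t = y ^ (1 - a) * (y ^ a * pdy U x y t) := by
      rw [← mul_assoc, ← Real.rpow_add hy0, sub_add_cancel, Real.rpow_one]
    rw [this, abs_mul, abs_of_pos (Real.rpow_pos_of_pos hy0 _)]
    exact mul_le_mul (Real.rpow_le_rpow hy0.le hy (by linarith)) hpy (abs_nonneg _)
      (by positivity)
  have h3 : |2 * t * pdt U x y t| ≤ 2 * |M| := by
    rw [abs_mul, abs_mul, abs_two]
    have ht1 : |t| ≤ 1 := abs_le.2 ⟨ht.1.le, by linarith [ht.2]⟩
    have := (hM x y t hy0 ht).trans (le_abs_self M)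
    have := mul_le_mul ht1 this (abs_nonneg _) zero_le_one
    linarith
  exact (abs_add_three _ _ _).trans (by linarith)

end SignoriniMem

lemma dilate_mem_Splus_of_le {n : ℕ} {r ρ : ℝ} (hr : 0 < r) (hρ : r ≤ ρ) {p : Pt n}
    (hp : p ∈ Splus n 1) : dilate r p ∈ Splus n ρ := by
  obtain ⟨h1, h2⟩ := (dilate_mem_Splus_iff hr p).2 hp
  refine ⟨h1, lt_of_le_of_lt ?_ h2.1, h2.2⟩
  nlinarith

lemma Hfn_eq_integral_dilate {n : ℕ} {a : ℝ} {U : Fn n} {r : ℝ} (hr : 0 < r) :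
    Hfn n a U r = ∫ p in Splus n 1,
      (U (dilate r p).1 (dilate r p).2.1 (dilate r p).2.2) ^ 2 * wgt n a p := by
  rw [Hfn, integral_Splus_eq hr fun p => (U p.1 p.2.1 p.2.2) ^ 2]
  field_simp

lemma four_div_mul_Ifn_eq_integral_dilate {n : ℕ} {a : ℝ} {U : Fn n} {r : ℝ} (hr : 0 < r) :
    4 / r * Ifn n a U r = ∫ p in Splus n 1,
      2 / r * (U (dilate r p).1 (dilate r p).2.1 (dilate r p).2.2 *
        Zop U (dilate r p).1 (dilate r p).2.1 (dilate r p).2.2) * wgt n a p := by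
  rw [Ifn, integral_Splus_eq hr fun p => U p.1 p.2.1 p.2.2 * Zop U p.1 p.2.1 p.2.2]
  simp_rw [mul_assoc (2 / r)]
  rw [integral_const_mul]
  field_simp
  ring

/-- The first variation formula holds at every radius in `(0,1)`. -/
lemma hasDerivAt_Hfn {n : ℕ} {a : ℝ} (ha₁ : -1 < a) (ha₂ : a < 1) {F U : Fn n}
    (hU : SignoriniMem n a F U) {r : ℝ} (hr : r ∈ Set.Ioo (0 : ℝ) 1) :
    HasDerivAt (Hfn n a U) (4 / r * Ifn n a U r) r := by
  obtain ⟨hr0, hr1⟩ := hr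
  obtain ⟨ρ, hrρ, hρ1⟩ := exists_between hr1
  have hρsq : ρ ^ 2 < 1 := by nlinarith
  obtain ⟨C, hC⟩ := hU.exists_abs_le hρsq
  obtain ⟨D, hD0, hD⟩ := hU.exists_abs_Zop_le ha₂
  have hnear : Set.Ioo (r / 2) ρ ∈ 𝓝 r := Ioo_mem_nhds (by linarith) hrρ
  have hmem : ∀ s ∈ Set.Ioo (r / 2) ρ, ∀ p : Pt n, p ∈ Splus n 1 →
      dilate s p ∈ Splus n ρ ∧ dilate s p ∈ Splus n 1 := by
    intro s hs p hp
    have hs0 : 0 < s := by linarith [hs.1]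
    exact ⟨dilate_mem_Splus_of_le hs0 hs.2.le hp,
      dilate_mem_Splus_of_le hs0 (by linarith [hs.2]) hp⟩
  have hmeas : ∀ s ∈ Set.Ioo (r / 2) ρ, AEStronglyMeasurable (fun p : Pt n =>
      (U (dilate s p).1 (dilate s p).2.1 (dilate s p).2.2) ^ 2 * wgt n a p)
      (volume.restrict (Splus n 1)) := by
    intro s hs
    have hc : ContinuousOn (fun p : Pt n => U p.1 p.2.1 p.2.2) (Splus n 1) :=
      fun p hp => (hU.differentiableAt hp).continuousAt.continuousWithinAt
    have := hc.comp (continuous_dilate s).continuousOn fun p hp => (hmem s hs p hp).2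
    exact ((this.pow 2).aestronglyMeasurable (measurableSet_Splus n 1)).mul
      (measurable_wgt n a).aestronglyMeasurable
  have hrmem : r ∈ Set.Ioo (r / 2) ρ := ⟨by linarith, hrρ⟩
  have key := hasDerivAt_integral_of_dominated_loc_of_deriv_le
    (μ := volume.restrict (Splus n 1)) (x₀ := r) (s := Set.Ioo (r / 2) ρ)
    (F := fun s (p : Pt n) =>
      (U (dilate s p).1 (dilate s p).2.1 (dilate s p).2.2) ^ 2 * wgt n a p)
    (F' := fun s (p : Pt n) =>
      2 / s * (U (dilate s p).1 (dilate s p).2.1 (dilate s p).2.2 *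
        Zop U (dilate s p).1 (dilate s p).2.1 (dilate s p).2.2) * wgt n a p)
    (bound := fun p => 4 / r * (C * D) * wgt n a p) hnear
    (by filter_upwards [hnear] with s hs using hmeas s hs) ?_ ?_ ?_
    ((integrableOn_wgt n ha₁).const_mul _) ?_
  · rw [four_div_mul_Ifn_eq_integral_dilate hr0]
    refine key.2.congr_of_eventuallyEq ?_
    filter_upwards [lt_mem_nhds hr0] with s hs using Hfn_eq_integral_dilate hs
  · refine ((integrableOn_wgt n ha₁).const_mul (C ^ 2)).mono' (hmeas r hrmem) ?_
    filter_upwards [ae_restrict_mem (measurableSet_Splus n 1)] with p hp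
    have hw := wgt_nonneg ha₁ hp.1
    rw [norm_mul, Real.norm_of_nonneg hw, norm_pow, Real.norm_eq_abs]
    gcongr
    exact hC _ (hmem r hrmem p hp).1
  · have := hU.continuousOn_mul_Zop.comp (continuous_dilate r).continuousOn
      fun p hp => (hmem r hrmem p hp).2
    exact ((this.aestronglyMeasurable (measurableSet_Splus n 1)).const_mul (2 / r)).mul
      (measurable_wgt n a).aestronglyMeasurable
  · filter_upwards [ae_restrict_mem (measurableSet_Splus n 1)] with p hp s hs
    have hw := wgt_nonneg ha₁ hp.1
    have hs0 : 0 < s := by linarith [hs.1]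
    obtain ⟨hm1, hm2⟩ := hmem s hs p hp
    have hC0 : 0 ≤ C := (abs_nonneg _).trans (hC _ hm1)
    rw [norm_mul, Real.norm_of_nonneg hw, norm_mul, Real.norm_of_nonneg (by positivity),
      Real.norm_eq_abs, abs_mul]
    have h1 : 2 / s ≤ 4 / r := by
      rw [div_le_div_iff₀ hs0 hr0]
      linarith [hs.1]
    have h2 : |U (dilate s p).1 (dilate s p).2.1 (dilate s p).2.2| *
        |Zop U (dilate s p).1 (dilate s p).2.1 (dilate s p).2.2| ≤ C * D := by
      by_cases h0 : U (dilate s p).1 (dilate s p).2.1 (dilate s p).2.2 = 0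
      · rw [h0, abs_zero, zero_mul]
        positivity
      · exact mul_le_mul (hC _ hm1) (hD _ hm2 h0) (abs_nonneg _) hC0
    gcongr
  · filter_upwards [ae_restrict_mem (measurableSet_Splus n 1)] with p hp s hs
    have hs0 : 0 < s := by linarith [hs.1]
    have := ((hasDerivAt_comp_dilate hs0 p (hU.differentiableAt (hmem s hs p hp).2)).pow 2)
    refine (this.mul_const (wgt n a p)).congr_deriv ?_
    simp only [Nat.cast_ofNat, Nat.add_one_sub_one, pow_one]
    ring

/-- first variation of the height, H'(U,r) = (4/r) I(U,r) for a.e. r. -/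
theorem first_variation_height (n : ℕ) (hn : 1 ≤ n) (a : ℝ) (ha₁ : -1 < a) (ha₂ : a < 1)
    (F U : Fn n) (hU : SignoriniMem n a F U)
    (hF : ∃ M : ℝ, ∀ x y t, 0 < y → t ∈ Set.Ioc (-1 : ℝ) 0 → |F x y t| ≤ M) :
    ∀ᵐ r ∂(volume.restrict (Set.Ioo (0 : ℝ) 1)),
      HasDerivAt (Hfn n a U) (4 / r * Ifn n a U r) r := by
  filter_upwards [ae_restrict_mem measurableSet_Ioo] with r hr
  exact hasDerivAt_Hfn ha₁ ha₂ hU hr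
end
end

section
/- Fix an integer n ≥ 1 and a ∈ (−1,1). For every polynomial function q(x,t) on ℝ^n × ℝ there exists a unique polynomial function q̃(x,y,t) on ℝ^{n+1} × ℝ such that: (i) q̃(x,0,t) = q(x,t) for all (x,t); (ii) q̃(x,−y,t) = q̃(x,y,t) for all (x,y,t); (iii) ∂_t q̃ − Δ_x q̃ − ∂_y² q̃ − (a/y) ∂_y q̃ = 0 at every point with y ≠ 0. Moreover, if q is parabolically homogeneous of degree κ (i.e. q(λx, λ²t) = λ^κ q(x,t) for all λ > 0), then q̃ is parabolically homogeneous of the same degree, i.e. q̃(λx, λy, λ²t) = λ^κ q̃(x,y,t) for all λ > 0. -/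
/- Formalization of results from "The structure of the singular set in the thin obstacle
problem for degenerate parabolic equations" by Banerjee, Danielli, Garofalo, Petrosyan.

Points of ℝ^{n+1} are written X = (x,y) with x : Fin n → ℝ and y : ℝ; functions of
space-time are `U : (Fin n → ℝ) → ℝ → ℝ → ℝ`, with `U x y t`. -/

noncomputable section

open MeasureTheory Filter Topology

namespace ACaloric

open MvPolynomial

/-- The operator `∂ₜ - Δₓ` on polynomials in `(x, t)`, the last variable being `t`. -/
def heatOp (n : ℕ) : MvPolynomial (Fin (n + 1)) ℝ →ₗ[ℝ] MvPolynomial (Fin (n + 1)) ℝ :=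
  (pderiv (Fin.last n)).toLinearMap -
    ∑ i : Fin n, (pderiv i.castSucc).toLinearMap ∘ₗ (pderiv i.castSucc).toLinearMap

theorem heatOp_apply {n : ℕ} (p : MvPolynomial (Fin (n + 1)) ℝ) :
    heatOp n p = pderiv (Fin.last n) p -
      ∑ i : Fin n, pderiv i.castSucc (pderiv i.castSucc p) := by
  simp [heatOp, LinearMap.sum_apply]

/-- All coefficients of `p` in degrees at least `d` vanish. -/
def CoeffsVanishFrom {σ : Type*} (d : ℕ) (p : MvPolynomial σ ℝ) : Prop :=
  ∀ m : σ →₀ ℕ, d ≤ m.degree → coeff m p = 0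

theorem CoeffsVanishFrom.mono {σ : Type*} {d e : ℕ} {p : MvPolynomial σ ℝ}
    (hp : CoeffsVanishFrom d p) (hde : d ≤ e) : CoeffsVanishFrom e p :=
  fun m hm => hp m (hde.trans hm)

theorem CoeffsVanishFrom.eq_zero {σ : Type*} {p : MvPolynomial σ ℝ}
    (hp : CoeffsVanishFrom 0 p) : p = 0 := by
  ext m
  simpa using hp m (Nat.zero_le _)

theorem coeffsVanishFrom_totalDegree_succ {σ : Type*} (p : MvPolynomial σ ℝ) :
    CoeffsVanishFrom (p.totalDegree + 1) p := by
  intro m hm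
  refine coeff_eq_zero_of_totalDegree_lt ?_
  rw [Finsupp.degree_apply] at hm
  exact hm

theorem CoeffsVanishFrom.pderiv {σ : Type*} {d : ℕ} {p : MvPolynomial σ ℝ}
    (hp : CoeffsVanishFrom d p) (i : σ) : CoeffsVanishFrom (d - 1) (pderiv i p) := by
  intro m hm
  rw [coeff_pderiv, hp, zero_mul]
  rw [map_add, Finsupp.degree_single]
  omega

theorem CoeffsVanishFrom.heatOp {n d : ℕ} {p : MvPolynomial (Fin (n + 1)) ℝ}
    (hp : CoeffsVanishFrom d p) : CoeffsVanishFrom (d - 1) (heatOp n p) := by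
  intro m hm
  rw [heatOp_apply, coeff_sub, coeff_sum, hp.pderiv _ m hm, zero_sub, neg_eq_zero]
  exact Finset.sum_eq_zero fun i _ => ((hp.pderiv _).pderiv _).mono (Nat.sub_le _ _) m hm

/-- The parabolic dilation `(x, t) ↦ (r x, r² t)` acting on polynomials in `(x, t)`. -/
def dilate (n : ℕ) (r : ℝ) : MvPolynomial (Fin (n + 1)) ℝ →ₐ[ℝ] MvPolynomial (Fin (n + 1)) ℝ :=
  aeval (Fin.snoc (fun i : Fin n => C r * X i.castSucc) (C (r ^ 2) * X (Fin.last n)))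

theorem eval_dilate {n : ℕ} (r : ℝ) (x : Fin n → ℝ) (t : ℝ)
    (p : MvPolynomial (Fin (n + 1)) ℝ) :
    eval (Fin.snoc x t : Fin (n + 1) → ℝ) (dilate n r p) =
      eval (Fin.snoc (r • x) (r ^ 2 * t) : Fin (n + 1) → ℝ) p := by
  induction p using MvPolynomial.induction_on with
  | C b => simp [dilate]
  | add p q hp hq => simp [hp, hq]
  | mul_X p i hp =>
    rw [map_mul, map_mul, hp, map_mul]
    congr 1
    refine Fin.lastCases ?_ (fun j => ?_) i <;> simp [dilate]

theorem pderiv_last_dilate {n : ℕ} (r : ℝ) (p : MvPolynomial (Fin (n + 1)) ℝ) :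
    pderiv (Fin.last n) (dilate n r p) = C (r ^ 2) * dilate n r (pderiv (Fin.last n) p) := by
  induction p using MvPolynomial.induction_on with
  | C b => simp [dilate]
  | add p q hp hq => simp only [map_add, hp, hq, mul_add]
  | mul_X p i hp =>
    simp only [map_mul, map_add, pderiv_mul, hp]
    refine Fin.lastCases ?_ (fun j => ?_) i
    · simp [dilate]
      ring
    · have hj : j.castSucc ≠ Fin.last n := Fin.castSucc_ne_last j
      simp [dilate, pderiv_X_of_ne hj]
      ring

theorem pderiv_castSucc_dilate {n : ℕ} (r : ℝ) (i : Fin n) (p : MvPolynomial (Fin (n + 1)) ℝ) :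
    pderiv i.castSucc (dilate n r p) = C r * dilate n r (pderiv i.castSucc p) := by
  induction p using MvPolynomial.induction_on with
  | C b => simp [dilate]
  | add p q hp hq => simp only [map_add, hp, hq, mul_add]
  | mul_X p k hp =>
    simp only [map_mul, map_add, pderiv_mul, hp]
    refine Fin.lastCases ?_ (fun j => ?_) k
    · have hi : Fin.last n ≠ i.castSucc := (Fin.castSucc_ne_last i).symm
      simp [dilate, pderiv_X_of_ne hi]
      ring
    · rcases eq_or_ne j i with rfl | hji
      · simp [dilate]
        ring
      · have hj : j.castSucc ≠ i.castSucc := fun h => hji (Fin.castSucc_injective n h)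
        simp [dilate, pderiv_X_of_ne hj]
        ring

theorem heatOp_dilate {n : ℕ} (r : ℝ) (p : MvPolynomial (Fin (n + 1)) ℝ) :
    heatOp n (dilate n r p) = C (r ^ 2) * dilate n r (heatOp n p) := by
  simp only [heatOp_apply, pderiv_last_dilate, pderiv_castSucc_dilate, map_sub, map_sum,
    pderiv_C_mul, mul_sub, Finset.mul_sum, map_pow]
  congr 1
  exact Finset.sum_congr rfl fun i _ => by ring

/-- Polynomials in `(x, t)` that agree at all points `Fin.snoc x t` are equal. -/
theorem mvPolynomial_ext_snoc {n : ℕ} {p q : MvPolynomial (Fin (n + 1)) ℝ}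
    (h : ∀ (x : Fin n → ℝ) (t : ℝ), eval (Fin.snoc x t : Fin (n + 1) → ℝ) p =
      eval (Fin.snoc x t : Fin (n + 1) → ℝ) q) : p = q := by
  refine MvPolynomial.funext fun v => ?_
  simpa using h (Fin.init v) (v (Fin.last n))

theorem hasDerivAt_eval_snoc {n : ℕ} (p : MvPolynomial (Fin (n + 1)) ℝ) (x : Fin n → ℝ) (t : ℝ) :
    HasDerivAt (fun s => eval (Fin.snoc x s : Fin (n + 1) → ℝ) p)
      (eval (Fin.snoc x t : Fin (n + 1) → ℝ) (pderiv (Fin.last n) p)) t := by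
  induction p using MvPolynomial.induction_on with
  | C b => simpa using hasDerivAt_const t b
  | add p q hp hq => simpa using hp.fun_add hq
  | mul_X p i hp =>
    refine Fin.lastCases ?_ (fun j => ?_) i
    · simpa [add_comm, mul_comm] using hp.fun_mul (hasDerivAt_id' t)
    · have hj : j.castSucc ≠ Fin.last n := Fin.castSucc_ne_last j
      simpa [pderiv_X_of_ne hj, mul_comm] using hp.mul_const (x j)

theorem hasFDerivAt_eval_snoc {n : ℕ} (p : MvPolynomial (Fin (n + 1)) ℝ)
    (x : Fin n → ℝ) (t : ℝ) :
    HasFDerivAt (fun z : Fin n → ℝ => eval (Fin.snoc z t : Fin (n + 1) → ℝ) p)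
      (∑ i : Fin n, eval (Fin.snoc x t : Fin (n + 1) → ℝ) (pderiv i.castSucc p) •
        (ContinuousLinearMap.proj i : (Fin n → ℝ) →L[ℝ] ℝ)) x := by
  induction p using MvPolynomial.induction_on with
  | C b => simpa using hasFDerivAt_const b x
  | add p q hp hq => simpa [add_smul, Finset.sum_add_distrib] using hp.fun_add hq
  | mul_X p k hp =>
    refine Fin.lastCases ?_ (fun j => ?_) k
    · have hi : ∀ i : Fin n, Fin.last n ≠ i.castSucc := fun i => (Fin.castSucc_ne_last i).symm
      simpa [pderiv_mul, pderiv_X_of_ne (hi _), Finset.smul_sum, smul_smul, mul_comm]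
        using hp.mul_const t
    · have h := hp.mul (ContinuousLinearMap.proj (R := ℝ) (φ := fun _ : Fin n => ℝ) j).hasFDerivAt
      simp only [map_mul, eval_X, Fin.snoc_castSucc]
      refine h.congr_fderiv ?_
      ext v
      simp [pderiv_X, Pi.single_apply, add_mul, Finset.sum_add_distrib, Finset.mul_sum, mul_assoc,
        apply_ite (eval _)]

/-- The polynomial function `∑_{k < N} c k (x, t) yᵏ`. -/
def evalSeq {n : ℕ} (N : ℕ) (c : ℕ → MvPolynomial (Fin (n + 1)) ℝ) : Fn n := fun x y t =>
  ∑ k ∈ Finset.range N, eval (Fin.snoc x t : Fin (n + 1) → ℝ) (c k) * y ^ k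

/-- The polynomial `∑_{k < N} c k (x, t) Yᵏ` in `Y`, for fixed `(x, t)`. -/
def slice {n : ℕ} (N : ℕ) (c : ℕ → MvPolynomial (Fin (n + 1)) ℝ) (x : Fin n → ℝ) (t : ℝ) :
    Polynomial ℝ :=
  ∑ k ∈ Finset.range N, Polynomial.monomial k (eval (Fin.snoc x t : Fin (n + 1) → ℝ) (c k))

section

variable {n N : ℕ} {c : ℕ → MvPolynomial (Fin (n + 1)) ℝ}

theorem eval_slice (x : Fin n → ℝ) (y t : ℝ) : (slice N c x t).eval y = evalSeq N c x y t := by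
  simp [slice, evalSeq, Polynomial.eval_finsetSum]

theorem coeff_slice (hc : ∀ k, N ≤ k → c k = 0) (x : Fin n → ℝ) (t : ℝ) (k : ℕ) :
    (slice N c x t).coeff k = eval (Fin.snoc x t : Fin (n + 1) → ℝ) (c k) := by
  simp only [slice, Polynomial.finsetSum_coeff, Polynomial.coeff_monomial, Finset.sum_ite_eq',
    Finset.mem_range]
  split_ifs with h
  · rfl
  · simp [hc k (not_lt.mp h)]

theorem pdt_evalSeq : pdt (evalSeq N c) = evalSeq N (fun k => pderiv (Fin.last n) (c k)) := by
  funext x y t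
  exact (HasDerivAt.fun_sum fun k _ => (hasDerivAt_eval_snoc (c k) x t).mul_const (y ^ k)).deriv

theorem pdx_evalSeq (i : Fin n) :
    pdx i (evalSeq N c) = evalSeq N (fun k => pderiv i.castSucc (c k)) := by
  funext x y t
  have h := HasFDerivAt.fun_sum (u := Finset.range N) fun k _ =>
    (hasFDerivAt_eval_snoc (c k) x t).mul_const (y ^ k)
  unfold pdx evalSeq
  rw [h.fderiv]
  simp [Pi.single_apply, mul_comm]

theorem pdy_evalSeq (x : Fin n → ℝ) (y t : ℝ) :
    pdy (evalSeq N c) x y t = (slice N c x t).derivative.eval y := by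
  unfold pdy
  simp only [← eval_slice, Polynomial.deriv]

theorem pdyy_evalSeq (x : Fin n → ℝ) (y t : ℝ) :
    pdyy (evalSeq N c) x y t = (slice N c x t).derivative.derivative.eval y := by
  unfold pdyy
  simp only [pdy_evalSeq]
  unfold pdy
  simp only [Polynomial.deriv]

theorem pdt_sub_lapx_evalSeq (x : Fin n → ℝ) (y t : ℝ) :
    pdt (evalSeq N c) x y t - lapx (evalSeq N c) x y t =
      (slice N (fun k => heatOp n (c k)) x t).eval y := by
  have h : lapx (evalSeq N c) x y t =
      ∑ i : Fin n, evalSeq N (fun k => pderiv i.castSucc (pderiv i.castSucc (c k))) x y t :=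
    Finset.sum_congr rfl fun i _ => by
      change pdx i (pdx i (evalSeq N c)) x y t = _
      rw [pdx_evalSeq, pdx_evalSeq]
  rw [h, pdt_evalSeq, eval_slice]
  simp only [evalSeq, heatOp_apply, map_sub, map_sum, sub_mul, Finset.sum_sub_distrib,
    Finset.sum_mul]
  rw [Finset.sum_comm]

/-- The `a`-caloric equation for `∑ c k yᵏ` away from `y = 0`, as a recurrence on `c`. -/
theorem acaloric_evalSeq_iff (a : ℝ) (hc : ∀ k, N ≤ k → c k = 0) (hc₁ : c 1 = 0) :
    (∀ x y t, y ≠ 0 → pdt (evalSeq N c) x y t - lapx (evalSeq N c) x y t -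
      pdyy (evalSeq N c) x y t - (a / y) * pdy (evalSeq N c) x y t = 0) ↔
    ∀ k : ℕ, heatOp n (c k) = C (((k : ℝ) + 2) * (k + 1 + a)) * c (k + 2) := by
  have hL : ∀ k, N ≤ k → heatOp n (c k) = 0 := fun k hk => by rw [hc k hk, map_zero]
  let E (x : Fin n → ℝ) (t : ℝ) : Polynomial ℝ :=
    Polynomial.X * (slice N (fun k => heatOp n (c k)) x t -
      (slice N c x t).derivative.derivative) - Polynomial.C a * (slice N c x t).derivative
  have eval_E : ∀ x y t, y ≠ 0 → (E x t).eval y = y * (pdt (evalSeq N c) x y t -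
      lapx (evalSeq N c) x y t - pdyy (evalSeq N c) x y t -
        (a / y) * pdy (evalSeq N c) x y t) := by
    intro x y t hy
    rw [pdt_sub_lapx_evalSeq, pdyy_evalSeq, pdy_evalSeq]
    simp only [E, Polynomial.eval_sub, Polynomial.eval_mul, Polynomial.eval_X, Polynomial.eval_C]
    field_simp
  have coeff_E_zero : ∀ x t, (E x t).coeff 0 = 0 := by
    intro x t
    simp [E, Polynomial.coeff_derivative, coeff_slice hc, hc₁]
  have coeff_E_succ : ∀ x t (k : ℕ), (E x t).coeff (k + 1) =
      eval (Fin.snoc x t : Fin (n + 1) → ℝ)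
        (heatOp n (c k) - C (((k : ℝ) + 2) * (k + 1 + a)) * c (k + 2)) := by
    intro x t k
    simp only [E, Polynomial.coeff_sub, Polynomial.coeff_X_mul, Polynomial.coeff_C_mul,
      Polynomial.coeff_derivative, coeff_slice hc, coeff_slice hL, map_sub, map_mul, eval_C]
    push_cast
    ring
  constructor
  · intro h k
    rw [← sub_eq_zero]
    refine mvPolynomial_ext_snoc fun x t => ?_
    have hE : E x t = 0 := by
      refine Polynomial.eq_zero_of_infinite_isRoot _
        ((Set.finite_singleton (0 : ℝ)).infinite_compl.mono fun y hy => ?_)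
      change (E x t).eval y = 0
      rw [eval_E x y t hy, h x y t hy, mul_zero]
    rw [← coeff_E_succ, hE, Polynomial.coeff_zero, map_zero]
  · intro h x y t hy
    have hE : E x t = 0 := by
      ext k
      rcases k with _ | k
      · simpa using coeff_E_zero x t
      · rw [coeff_E_succ, h, sub_self, map_zero, Polynomial.coeff_zero]
    have := eval_E x y t hy
    rw [hE, Polynomial.eval_zero] at this
    exact (mul_eq_zero.mp this.symm).resolve_left hy

theorem evalSeq_zero (hc : ∀ k, N ≤ k → c k = 0) (x : Fin n → ℝ) (t : ℝ) :
    evalSeq N c x 0 t = eval (Fin.snoc x t : Fin (n + 1) → ℝ) (c 0) := by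
  rw [← eval_slice, ← Polynomial.coeff_zero_eq_eval_zero, coeff_slice hc]

theorem coeff_one_eq_zero_of_even (hc : ∀ k, N ≤ k → c k = 0)
    (heven : ∀ x y t, evalSeq N c x (-y) t = evalSeq N c x y t) : c 1 = 0 := by
  refine mvPolynomial_ext_snoc fun x t => ?_
  have h : (slice N c x t).comp (-Polynomial.X) = slice N c x t :=
    Polynomial.funext fun y => by simp [eval_slice, heven]
  have h₁ := congrArg (fun p => p.derivative.eval 0) h
  have h₀ : (slice N c x t).derivative.eval 0 = eval (Fin.snoc x t : Fin (n + 1) → ℝ) (c 1) := by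
    simp [← Polynomial.coeff_zero_eq_eval_zero, Polynomial.coeff_derivative, coeff_slice hc]
  simp only [Polynomial.derivative_comp, Polynomial.derivative_neg, Polynomial.derivative_X,
    Polynomial.eval_mul, Polynomial.eval_neg, Polynomial.eval_one, Polynomial.eval_comp,
    Polynomial.eval_X, neg_zero, h₀] at h₁
  rw [map_zero]
  linarith

theorem isPolyFun3_evalSeq : IsPolyFun3 n (evalSeq N c) := by
  refine ⟨∑ k ∈ Finset.range N,
    rename (Fin.snoc (fun i : Fin n => i.castSucc.castSucc) (Fin.last (n + 1))) (c k) *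
      X (Fin.last n).castSucc ^ k, fun x y t => ?_⟩
  simp only [evalSeq, map_sum, map_mul, map_pow, eval_X, Fin.snoc_castSucc, Fin.snoc_last,
    eval_rename]
  refine Finset.sum_congr rfl fun k _ => ?_
  congr 3
  funext i
  refine Fin.lastCases ?_ (fun j => ?_) i <;> simp

end

theorem exists_evalSeq_of_isPolyFun3 {n : ℕ} {q : Fn n} (hq : IsPolyFun3 n q) :
    ∃ (N : ℕ) (c : ℕ → MvPolynomial (Fin (n + 1)) ℝ),
      (∀ k, N ≤ k → c k = 0) ∧ q = evalSeq N c := by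
  obtain ⟨P, hP⟩ := hq
  let g : Fin (n + 2) → Polynomial (MvPolynomial (Fin (n + 1)) ℝ) :=
    Fin.snoc (Fin.snoc (fun i : Fin n => Polynomial.C (X i.castSucc)) Polynomial.X)
      (Polynomial.C (X (Fin.last n)))
  have key : ∀ (x : Fin n → ℝ) (y t : ℝ) (p : MvPolynomial (Fin (n + 2)) ℝ),
      eval (Fin.snoc (Fin.snoc x y) t : Fin (n + 2) → ℝ) p =
        (aeval g p).eval₂ (eval (Fin.snoc x t : Fin (n + 1) → ℝ)) y := by
    intro x y t p
    induction p using MvPolynomial.induction_on with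
    | C b =>
      simp [Polynomial.algebraMap_apply, MvPolynomial.algebraMap_eq]
    | add p q hp hq => simp [hp, hq, Polynomial.eval₂_add]
    | mul_X p i hp =>
      rw [map_mul, map_mul, Polynomial.eval₂_mul, hp, eval_X, aeval_X]
      congr 1
      refine Fin.lastCases ?_ (fun j => ?_) i
      · simp [g]
      · refine Fin.lastCases ?_ (fun l => ?_) j <;> simp [g]
  refine ⟨(aeval g P).natDegree + 1, (aeval g P).coeff, fun k hk =>
    Polynomial.coeff_eq_zero_of_natDegree_lt hk, ?_⟩
  funext x y t
  rw [hP, key, Polynomial.eval₂_eq_sum_range]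
  rfl

/-- The coefficients in `y` of the `a`-caloric extension of `p`. -/
def extensionSeq {n : ℕ} (a : ℝ) (p : MvPolynomial (Fin (n + 1)) ℝ) :
    ℕ → MvPolynomial (Fin (n + 1)) ℝ
  | 0 => p
  | 1 => 0
  | k + 2 => C ((((k : ℝ) + 2) * (k + 1 + a))⁻¹) * heatOp n (extensionSeq a p k)

theorem indicial_ne_zero {a : ℝ} (ha : -1 < a) (k : ℕ) : ((k : ℝ) + 2) * (k + 1 + a) ≠ 0 := by
  have hk : (0 : ℝ) ≤ k := k.cast_nonneg
  have h : 0 < (k : ℝ) + 1 + a := by linarith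
  positivity

section

variable {n : ℕ} (a : ℝ) (p : MvPolynomial (Fin (n + 1)) ℝ)

theorem heatOp_extensionSeq {a : ℝ} (ha : -1 < a) (k : ℕ) :
    heatOp n (extensionSeq a p k) =
      C (((k : ℝ) + 2) * (k + 1 + a)) * extensionSeq a p (k + 2) := by
  rw [extensionSeq, ← mul_assoc, ← C_mul, mul_inv_cancel₀ (indicial_ne_zero ha k), C_1, one_mul]

theorem extensionSeq_odd (k : ℕ) : extensionSeq a p (2 * k + 1) = 0 := by
  induction k with
  | zero => rfl
  | succ k ih =>
    change extensionSeq a p (2 * k + 1 + 2) = 0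
    rw [extensionSeq, ih, map_zero, mul_zero]

theorem coeffsVanishFrom_extensionSeq (k : ℕ) :
    CoeffsVanishFrom (p.totalDegree + 1 - k / 2) (extensionSeq a p k) := by
  induction k using Nat.twoStepInduction with
  | zero => exact coeffsVanishFrom_totalDegree_succ p
  | one => exact fun m _ => coeff_zero m
  | more k ih _ =>
    intro m hm
    rw [extensionSeq, coeff_C_mul, ih.heatOp m (by omega), mul_zero]

theorem extensionSeq_eq_zero {k : ℕ} (hk : 2 * (p.totalDegree + 1) ≤ k) :
    extensionSeq a p k = 0 :=
  ((coeffsVanishFrom_extensionSeq a p k).mono (by omega)).eq_zero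

end

theorem eq_of_recurrence {n : ℕ} {a : ℝ} (ha : -1 < a) {c d : ℕ → MvPolynomial (Fin (n + 1)) ℝ}
    (hc : ∀ k : ℕ, heatOp n (c k) = C (((k : ℝ) + 2) * (k + 1 + a)) * c (k + 2))
    (hd : ∀ k : ℕ, heatOp n (d k) = C (((k : ℝ) + 2) * (k + 1 + a)) * d (k + 2))
    (h₀ : c 0 = d 0) (h₁ : c 1 = d 1) : c = d := by
  funext k
  induction k using Nat.twoStepInduction with
  | zero => exact h₀
  | one => exact h₁
  | more k ih _ =>
    refine mul_left_cancel₀ (C_ne_zero.mpr (indicial_ne_zero ha k)) ?_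
    rw [← hc, ← hd, ih]

theorem dilate_of_recurrence {n : ℕ} {a : ℝ} (ha : -1 < a)
    {c : ℕ → MvPolynomial (Fin (n + 1)) ℝ}
    (hc : ∀ k : ℕ, heatOp n (c k) = C (((k : ℝ) + 2) * (k + 1 + a)) * c (k + 2))
    {r s : ℝ} (h₀ : dilate n r (c 0) = C s * c 0) (h₁ : c 1 = 0) (k : ℕ) :
    C (r ^ k) * dilate n r (c k) = C s * c k := by
  have hsmul : ∀ (b : ℝ) (p : MvPolynomial (Fin (n + 1)) ℝ),
      heatOp n (C b * p) = C b * heatOp n p := fun b p => by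
    rw [← smul_eq_C_mul, map_smul, smul_eq_C_mul]
  have hdil : ∀ b : ℝ, dilate n r (C b) = C b := fun b => by simp [dilate, algebraMap_eq]
  refine congrFun (eq_of_recurrence (c := fun k => C (r ^ k) * dilate n r (c k))
    (d := fun k => C s * c k) ha (fun k => ?_) (fun k => ?_) ?_ ?_) k
  · simp only [hsmul, heatOp_dilate, hc, map_mul, hdil]
    rw [pow_add, C_mul]
    ring
  · simp only [hsmul, hc]
    ring
  · simpa using h₀
  · simp [h₁]

theorem evalSeq_dilate {n N : ℕ} {c : ℕ → MvPolynomial (Fin (n + 1)) ℝ} {r s : ℝ}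
    (h : ∀ k, C (r ^ k) * dilate n r (c k) = C s * c k) (x : Fin n → ℝ) (y t : ℝ) :
    evalSeq N c (r • x) (r * y) (r ^ 2 * t) = s * evalSeq N c x y t := by
  simp only [evalSeq, Finset.mul_sum]
  refine Finset.sum_congr rfl fun k _ => ?_
  have hk := congrArg (eval (Fin.snoc x t : Fin (n + 1) → ℝ)) (h k)
  simp only [map_mul, eval_C, eval_dilate] at hk
  rw [mul_pow, ← mul_assoc s, ← hk]
  ring

theorem evalSeq_extensionSeq_neg {n : ℕ} (N : ℕ) (a : ℝ) (p : MvPolynomial (Fin (n + 1)) ℝ)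
    (x : Fin n → ℝ) (y t : ℝ) :
    evalSeq N (extensionSeq a p) x (-y) t = evalSeq N (extensionSeq a p) x y t := by
  refine Finset.sum_congr rfl fun k _ => ?_
  rcases Nat.even_or_odd k with hk | ⟨m, rfl⟩
  · rw [hk.neg_pow]
  · rw [extensionSeq_odd, map_zero, zero_mul, zero_mul]

theorem evalSeq_eq_of_le {n N M : ℕ} {c : ℕ → MvPolynomial (Fin (n + 1)) ℝ}
    (hN : ∀ k, N ≤ k → c k = 0) (hM : ∀ k, M ≤ k → c k = 0) : evalSeq N c = evalSeq M c := by
  funext x y t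
  rw [← eval_slice, ← eval_slice]
  congr 1
  ext k
  rw [coeff_slice hN, coeff_slice hM]

end ACaloric

open ACaloric

/-- a-caloric extension of polynomials (Lemma 3.2). -/
theorem acaloric_extension_of_polynomials (n : ℕ) (hn : 1 ≤ n)
    (a : ℝ) (ha₁ : -1 < a) (ha₂ : a < 1)
    (q : (Fin n → ℝ) → ℝ → ℝ) (hq : IsPolyFun2 n q) :
    ∃ qt : Fn n,
      (IsPolyFun3 n qt ∧ (∀ x t, qt x 0 t = q x t) ∧
        (∀ x y t, qt x (-y) t = qt x y t) ∧
        (∀ x y t, y ≠ 0 →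
          pdt qt x y t - lapx qt x y t - pdyy qt x y t - (a / y) * pdy qt x y t = 0)) ∧
      (∀ qt' : Fn n,
        (IsPolyFun3 n qt' ∧ (∀ x t, qt' x 0 t = q x t) ∧
          (∀ x y t, qt' x (-y) t = qt' x y t) ∧
          (∀ x y t, y ≠ 0 →
            pdt qt' x y t - lapx qt' x y t - pdyy qt' x y t - (a / y) * pdy qt' x y t = 0)) →
        qt' = qt) ∧
      (∀ κ : ℝ, (∀ lam > (0:ℝ), ∀ x t, q (lam • x) (lam ^ 2 * t) = lam ^ κ * q x t) →
        ∀ lam > (0:ℝ), ∀ x y t,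
          qt (lam • x) (lam * y) (lam ^ 2 * t) = lam ^ κ * qt x y t) := by
  obtain ⟨P, hP⟩ := hq
  set N := 2 * (P.totalDegree + 1)
  have hvanish : ∀ k, N ≤ k → extensionSeq a P k = 0 := fun k hk => extensionSeq_eq_zero a P hk
  have hrec := fun k => heatOp_extensionSeq P ha₁ k
  refine ⟨evalSeq N (extensionSeq a P), ⟨isPolyFun3_evalSeq, fun x t => ?_,
    evalSeq_extensionSeq_neg N a P, (acaloric_evalSeq_iff a hvanish rfl).mpr hrec⟩, ?_, ?_⟩
  · rw [evalSeq_zero hvanish, hP]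
    rfl
  · rintro qt' ⟨hpoly, htrace, heven, hpde⟩
    obtain ⟨M, c, hM, rfl⟩ := exists_evalSeq_of_isPolyFun3 hpoly
    have hc₁ : c 1 = 0 := coeff_one_eq_zero_of_even hM heven
    have hc₀ : c 0 = P := mvPolynomial_ext_snoc fun x t => by
      rw [← evalSeq_zero hM, htrace, hP]
    obtain rfl : c = extensionSeq a P :=
      eq_of_recurrence ha₁ ((acaloric_evalSeq_iff a hM hc₁).mp hpde) hrec hc₀ hc₁
    exact evalSeq_eq_of_le hM hvanish
  · intro κ hκ r hr
    refine evalSeq_dilate (dilate_of_recurrence ha₁ hrec ?_ rfl)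
    refine mvPolynomial_ext_snoc fun x t => ?_
    have h := hκ r hr x t
    rw [hP, hP] at h
    rw [eval_dilate, map_mul, MvPolynomial.eval_C]
    exact h
end
end
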